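/- If Γ = (V,q) is centered for m, then the Markov chain X with kernel q is recurrent if and only if the symmetrized chain X⁰ with kernel q⁰(x,y) = (q(x,y) + (m(y)/m(x))q(y,x))/2 is recurrent. -/

import Mathlib

open scoped Classical

/-- The edge `(a,b)` belongs to the cycle with vertices `x 0, x 1, ..., x k` (where `x k = x 0`). -/
def IsEdge {V : Type*} (k : ℕ) (x : ℕ → V) (a b : V) : Prop :=
  ∃ j, j < k ∧ x j = a ∧ x (j + 1) = b

/-- The graph `Γ = (V,q)` is centered for the measure `m`, witnessed by the family of
edge self-avoiding closed cycles `γ i = (vert i 0, ..., vert i (len i))` with positive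
weights `w i` and uniform length bound `C0`, so that
`m x * q x y = ∑' i, w i · 1_{(x,y) ∈ γ i}`. -/
def Centered {V : Type*} (q : V → V → ℝ) (m : V → ℝ)
    (len : ℕ → ℕ) (vert : ℕ → ℕ → V) (w : ℕ → ℝ) (C0 : ℕ) : Prop :=
  (∀ i, 1 ≤ len i ∧ len i ≤ C0) ∧
  (∀ i, vert i (len i) = vert i 0) ∧
  (∀ i j, j < len i → 0 < q (vert i j) (vert i (j + 1))) ∧
  (∀ i j j', j < len i → j' < len i →
      vert i j = vert i j' → vert i (j + 1) = vert i (j' + 1) → j = j') ∧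
  (∀ i, 0 < w i) ∧
  (∀ x y, m x * q x y = ∑' i, if IsEdge (len i) (vert i) x y then w i else 0)


/-- `t`-step transition kernel of the chain with kernel `Q` (values in `ℝ≥0∞`). -/
noncomputable def kerPow {V : Type*} (Q : V → V → ENNReal) : ℕ → V → V → ENNReal
  | 0 => fun x y => if x = y then 1 else 0
  | (t + 1) => fun x y => ∑' z : V, kerPow Q t x z * Q z y

/-- Green kernel at the diagonal: `g(x,x) = ∑_{t ≥ 0} P[X_t = x | X_0 = x]`. -/
noncomputable def green {V : Type*} (Q : V → V → ENNReal) (x : V) : ENNReal :=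
  ∑' t : ℕ, kerPow Q t x x


/-- The number of passages of the closed path `x 0, ..., x k` at `a`. -/
noncomputable def visits {V : Type*} (k : ℕ) (x : ℕ → V) (a : V) : ℝ :=
  ∑ j ∈ Finset.range k, if x j = a then 1 else 0

/-- The number of times the path `x 0, ..., x k` uses the edge `(a,b)`. -/
noncomputable def crossings {V : Type*} (k : ℕ) (x : ℕ → V) (a b : V) : ℝ :=
  ∑ j ∈ Finset.range k, if x j = a ∧ x (j + 1) = b then 1 else 0

lemma visits_nonneg {V : Type*} (k : ℕ) (x : ℕ → V) (a : V) : 0 ≤ visits k x a :=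
  Finset.sum_nonneg fun _ _ => by split_ifs <;> norm_num

lemma crossings_nonneg {V : Type*} (k : ℕ) (x : ℕ → V) (a b : V) : 0 ≤ crossings k x a b :=
  Finset.sum_nonneg fun _ _ => by split_ifs <;> norm_num

/-- A sum over one period of a periodic sequence is invariant under the shift. -/
lemma sum_range_shift_of_closed (k : ℕ) (f : ℕ → ℝ) (hf : f k = f 0) :
    ∑ j ∈ Finset.range k, f (j + 1) = ∑ j ∈ Finset.range k, f j := by
  have h1 := Finset.sum_range_succ f k
  have h2 := Finset.sum_range_succ' f k
  linarith

lemma sum_visits_mul {V : Type*} (k : ℕ) (x : ℕ → V) (B : Finset V) (f : V → ℝ)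
    (hf : ∀ a, a ∉ B → f a = 0) :
    ∑ a ∈ B, visits k x a * f a = ∑ j ∈ Finset.range k, f (x j) := by
  simp only [visits, Finset.sum_mul]
  rw [Finset.sum_comm]
  refine Finset.sum_congr rfl fun j _ => ?_
  by_cases h : x j ∈ B
  · simp [ite_mul, h]
  · simp [ite_mul, h, hf _ h]

lemma sum_crossings_mul {V : Type*} (k : ℕ) (x : ℕ → V) (B : Finset V) (f g : V → ℝ)
    (hf : ∀ a, a ∉ B → f a = 0) (hg : ∀ a, a ∉ B → g a = 0) :
    ∑ a ∈ B, ∑ b ∈ B, crossings k x a b * (f a * g b) =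
      ∑ j ∈ Finset.range k, f (x j) * g (x (j + 1)) := by
  have h1 : ∀ a b, crossings k x a b * (f a * g b) =
      ∑ j ∈ Finset.range k, (if x j = a then f a else 0) * (if x (j + 1) = b then g b else 0) := by
    intro a b
    rw [crossings, Finset.sum_mul]
    refine Finset.sum_congr rfl fun j _ => ?_
    split_ifs <;> simp_all
  simp only [h1]
  have h2 : ∀ a, ∑ b ∈ B, ∑ j ∈ Finset.range k,
      (if x j = a then f a else 0) * (if x (j + 1) = b then g b else 0) =
      ∑ j ∈ Finset.range k, (if x j = a then f a else 0) * g (x (j + 1)) := by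
    intro a
    rw [Finset.sum_comm]
    refine Finset.sum_congr rfl fun j _ => ?_
    rw [← Finset.mul_sum, Finset.sum_ite_eq]
    split_ifs with h3 h4 <;> simp_all
  simp only [h2]
  rw [Finset.sum_comm]
  refine Finset.sum_congr rfl fun j _ => ?_
  rw [← Finset.sum_mul, Finset.sum_ite_eq]
  split_ifs with h3 <;> simp_all

lemma sum_crossings_le_visits {V : Type*} (k : ℕ) (x : ℕ → V) (hx : x k = x 0) (B : Finset V)
    (b : V) : ∑ a ∈ B, crossings k x a b ≤ visits k x b := by
  have h : visits k x b = ∑ j ∈ Finset.range k, if x (j + 1) = b then (1 : ℝ) else 0 :=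
    (sum_range_shift_of_closed k (fun j => if x j = b then (1 : ℝ) else 0) (by simp [hx])).symm
  rw [h]
  simp only [crossings]
  rw [Finset.sum_comm]
  refine Finset.sum_le_sum fun j _ => ?_
  by_cases h : x (j + 1) = b
  · simp only [h, and_true, Finset.sum_ite_eq, if_true]
    split_ifs <;> norm_num
  · simp [h]

lemma ite_isEdge_eq {V : Type*} (k : ℕ) (x : ℕ → V)
    (hx : ∀ j j', j < k → j' < k → x j = x j' → x (j + 1) = x (j' + 1) → j = j')
    (a b : V) (w : ℝ) :
    (if IsEdge k x a b then w else 0) = w * crossings k x a b := by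
  split_ifs with h
  · obtain ⟨j, hj, rfl, rfl⟩ := h
    rw [crossings, Finset.sum_eq_single_of_mem j (Finset.mem_range.2 hj)]
    · simp
    · intro j' hj' hne
      rw [if_neg]
      rintro ⟨h1, h2⟩
      exact hne (hx j' j (Finset.mem_range.1 hj') hj h1 h2)
  · rw [crossings, Finset.sum_eq_zero, mul_zero]
    intro j hj
    rw [if_neg]
    exact fun h1 => h ⟨j, Finset.mem_range.1 hj, h1⟩

/-- Dirichlet sum along a closed cycle. -/
lemma sum_closed_self (k : ℕ) (f : ℕ → ℝ) (hf : f k = f 0) :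
    ∑ j ∈ Finset.range k, f j * (f j - f (j + 1)) =
      (∑ j ∈ Finset.range k, (f j - f (j + 1)) ^ 2) / 2 := by
  have h := sum_range_shift_of_closed k (fun j => f j ^ 2) (by simp [hf])
  have h2 : ∑ j ∈ Finset.range k, (f j - f (j + 1)) ^ 2 =
      2 * ∑ j ∈ Finset.range k, f j * (f j - f (j + 1)) +
        ∑ j ∈ Finset.range k, f (j + 1) ^ 2 - ∑ j ∈ Finset.range k, f j ^ 2 := by
    rw [Finset.mul_sum, ← Finset.sum_add_distrib, ← Finset.sum_sub_distrib]
    exact Finset.sum_congr rfl fun j _ => by ring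
  linarith

lemma sub_sq_le_card_mul_sum_sq (k j : ℕ) (hj : j ≤ k) (f : ℕ → ℝ) :
    (f j - f 0) ^ 2 ≤ k * ∑ i ∈ Finset.range k, (f i - f (i + 1)) ^ 2 := by
  have h1 : f j - f 0 = - ∑ i ∈ Finset.range j, (f i - f (i + 1)) := by
    rw [Finset.sum_range_sub']; ring
  have h2 := sq_sum_le_card_mul_sum_sq (s := Finset.range j) (f := fun i => f i - f (i + 1))
  rw [h1, neg_sq]
  refine h2.trans ?_
  rw [Finset.card_range]
  refine mul_le_mul (by exact_mod_cast hj) ?_ (Finset.sum_nonneg fun _ _ => sq_nonneg _)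
    (Nat.cast_nonneg _)
  exact Finset.sum_le_sum_of_subset_of_nonneg (Finset.range_mono hj) fun _ _ _ => sq_nonneg _

/-- The sector condition along one closed cycle. -/
lemma sum_closed_sector (k C : ℕ) (hk : k ≤ C) (f g : ℕ → ℝ) (hf : f k = f 0) (hg : g k = g 0) :
    ∑ j ∈ Finset.range k, f j * (g j - g (j + 1)) ≤
      2 * (C : ℝ) ^ 2 * ∑ j ∈ Finset.range k, f j * (f j - f (j + 1)) +
        1 / 2 * ∑ j ∈ Finset.range k, g j * (g j - g (j + 1)) := by
  rw [sum_closed_self k f hf, sum_closed_self k g hg]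
  have h0 : ∑ j ∈ Finset.range k, f j * (g j - g (j + 1)) =
      ∑ j ∈ Finset.range k, (f j - f 0) * (g j - g (j + 1)) := by
    have h : ∑ j ∈ Finset.range k, f 0 * (g j - g (j + 1)) = 0 := by
      rw [← Finset.mul_sum, Finset.sum_range_sub', hg, sub_self, mul_zero]
    simp only [sub_mul (f _) (f 0), Finset.sum_sub_distrib, h, sub_zero]
  have h1 : ∑ j ∈ Finset.range k, (f j - f 0) * (g j - g (j + 1)) ≤
      ∑ j ∈ Finset.range k, (((k : ℝ) * ∑ i ∈ Finset.range k, (f i - f (i + 1)) ^ 2) +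
        1 / 4 * (g j - g (j + 1)) ^ 2) := by
    refine Finset.sum_le_sum fun j hj => ?_
    have := sub_sq_le_card_mul_sum_sq k j (Finset.mem_range.1 hj).le f
    nlinarith [sq_nonneg ((f j - f 0) - (g j - g (j + 1)) / 2)]
  rw [Finset.sum_add_distrib, Finset.sum_const, Finset.card_range, nsmul_eq_mul,
    ← Finset.mul_sum] at h1
  have h2 : (0 : ℝ) ≤ ∑ i ∈ Finset.range k, (f i - f (i + 1)) ^ 2 :=
    Finset.sum_nonneg fun _ _ => sq_nonneg _
  have h3 : (k : ℝ) * k ≤ (C : ℝ) ^ 2 := by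
    rw [sq]; exact_mod_cast Nat.mul_le_mul hk hk
  have h4 := mul_le_mul_of_nonneg_right h3 h2
  rw [h0]
  linarith

lemma summable_of_tsum_eq_one {α : Type*} {f : α → ℝ} (h : ∑' a, f a = 1) : Summable f := by
  by_contra hns
  rw [tsum_eq_zero_of_not_summable hns] at h
  exact zero_ne_one h

section Centered

variable {V : Type*} {q : V → V → ℝ} {m : V → ℝ} {len : ℕ → ℕ} {vert : ℕ → ℕ → V} {w : ℕ → ℝ}
  {C0 : ℕ}

lemma Centered.hasSum_crossings (hc : Centered q m len vert w C0) (hm : ∀ x, 0 < m x) (a b : V) :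
    HasSum (fun i => w i * crossings (len i) (vert i) a b) (m a * q a b) := by
  obtain ⟨-, -, hpos, hinj, -, hsum⟩ := hc
  have he : (fun i => w i * crossings (len i) (vert i) a b) =
      fun i => if IsEdge (len i) (vert i) a b then w i else 0 :=
    funext fun i => (ite_isEdge_eq _ _ (hinj i) a b (w i)).symm
  rw [he, hsum]
  by_cases hE : ∃ i, IsEdge (len i) (vert i) a b
  · obtain ⟨i, j, hj, rfl, rfl⟩ := hE
    refine Summable.hasSum ?_
    by_contra hns
    have h0 := hsum (vert i j) (vert i (j + 1))
    rw [tsum_eq_zero_of_not_summable hns] at h0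
    exact (mul_pos (hm _) (hpos i j hj)).ne' h0
  · push Not at hE
    simp [hE]

lemma Centered.hasSum_visits (hc : Centered q m len vert w C0) (hm : ∀ x, 0 < m x)
    (hq : ∀ x y, 0 ≤ q x y) (hker : ∀ x, ∑' y, q x y = 1) (a : V) :
    HasSum (fun i => w i * visits (len i) (vert i) a) (m a) := by
  have hw : ∀ i, 0 ≤ w i := fun i => (hc.2.2.2.2.1 i).le
  have hs := summable_of_tsum_eq_one (hker a)
  have hma : ENNReal.ofReal (m a) = ∑' b, ENNReal.ofReal (m a * q a b) := by
    rw [← ENNReal.ofReal_tsum_of_nonneg (fun b => mul_nonneg (hm a).le (hq a b)) (hs.mul_left _),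
      tsum_mul_left, hker, mul_one]
  have hvis : ∀ i, ∑' b, ENNReal.ofReal (w i * crossings (len i) (vert i) a b) =
      ENNReal.ofReal (w i * visits (len i) (vert i) a) := by
    intro i
    simp only [ENNReal.ofReal_mul (hw i), ENNReal.tsum_mul_left]
    congr 1
    simp only [crossings, visits]
    rw [ENNReal.ofReal_sum_of_nonneg (fun _ _ => by split_ifs <;> norm_num)]
    have : ∀ b, ENNReal.ofReal (∑ j ∈ Finset.range (len i),
        if vert i j = a ∧ vert i (j + 1) = b then (1 : ℝ) else 0) =
        ∑ j ∈ Finset.range (len i),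
          if vert i (j + 1) = b then (if vert i j = a then (1 : ENNReal) else 0) else 0 := by
      intro b
      rw [ENNReal.ofReal_sum_of_nonneg (fun _ _ => by split_ifs <;> norm_num)]
      refine Finset.sum_congr rfl fun j _ => ?_
      split_ifs <;> simp_all
    simp only [this]
    rw [Summable.tsum_finsetSum fun _ _ => ENNReal.summable]
    refine Finset.sum_congr rfl fun j _ => ?_
    rw [tsum_eq_single (vert i (j + 1)) (fun b hb => if_neg (Ne.symm hb)), if_pos rfl]
    split_ifs <;> simp
  have htot : ∑' i, ENNReal.ofReal (w i * visits (len i) (vert i) a) = ENNReal.ofReal (m a) := by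
    rw [hma]
    simp only [← hvis]
    rw [ENNReal.tsum_comm]
    refine tsum_congr fun b => ?_
    have hb := hc.hasSum_crossings hm a b
    rw [← ENNReal.ofReal_tsum_of_nonneg
      (fun i => mul_nonneg (hw i) (crossings_nonneg _ _ _ _)) hb.summable, hb.tsum_eq]
  have h := ENNReal.hasSum_toReal (htot.trans_ne ENNReal.ofReal_ne_top)
  rw [← ENNReal.tsum_toReal_eq (fun _ => ENNReal.ofReal_ne_top), htot,
    ENNReal.toReal_ofReal (hm a).le] at h
  convert h using 2 with i
  exact (ENNReal.toReal_ofReal (mul_nonneg (hw i) (visits_nonneg _ _ _))).symm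

/-- `m` is excessive for `q`. -/
lemma Centered.sum_mul_le (hc : Centered q m len vert w C0) (hm : ∀ x, 0 < m x)
    (hq : ∀ x y, 0 ≤ q x y) (hker : ∀ x, ∑' y, q x y = 1) (B : Finset V) (b : V) :
    ∑ a ∈ B, m a * q a b ≤ m b := by
  refine hasSum_le (fun i => ?_) (hasSum_sum fun a _ => hc.hasSum_crossings hm a b)
    (hc.hasSum_visits hm hq hker b)
  rw [← Finset.mul_sum]
  exact mul_le_mul_of_nonneg_left (sum_crossings_le_visits _ _ (hc.2.1 i) _ _) (hc.2.2.2.2.1 i).le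

/-- Cycle decomposition of the form `(u, v) ↦ ⟨(I - q) v, u⟩_m` on functions supported in `B`. -/
lemma Centered.hasSum_form (hc : Centered q m len vert w C0) (hm : ∀ x, 0 < m x)
    (hq : ∀ x y, 0 ≤ q x y) (hker : ∀ x, ∑' y, q x y = 1) (B : Finset V) (u v : V → ℝ)
    (hu : ∀ a, a ∉ B → u a = 0) (hv : ∀ a, a ∉ B → v a = 0) :
    HasSum (fun i => w i * ∑ j ∈ Finset.range (len i),
        u (vert i j) * (v (vert i j) - v (vert i (j + 1))))
      (∑ a ∈ B, m a * (u a * v a) - ∑ a ∈ B, ∑ b ∈ B, m a * q a b * (u a * v b)) := by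
  have h1 := hasSum_sum fun a (_ : a ∈ B) =>
    (hc.hasSum_visits hm hq hker a).mul_right (u a * v a)
  have h2 := hasSum_sum fun a (_ : a ∈ B) => hasSum_sum fun b (_ : b ∈ B) =>
    (hc.hasSum_crossings hm a b).mul_right (u a * v b)
  refine Eq.mp (congrArg (fun f => HasSum f _) (funext fun i => ?_)) (h1.sub h2)
  symm
  simp only [mul_assoc, ← Finset.mul_sum]
  rw [sum_visits_mul _ _ B (fun a => u a * v a) (fun a ha => by simp [hu a ha]),
    sum_crossings_mul _ _ B u v hu hv, ← mul_sub, ← Finset.sum_sub_distrib]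
  simp only [mul_sub]

end Centered

section Green

variable {V : Type*}

lemma tsum_kerPow_le {Q : V → V → ENNReal} {c : ENNReal} (hQ : ∀ a, ∑' b, Q a b ≤ c) (x : V)
    (t : ℕ) : ∑' y, kerPow Q t x y ≤ c ^ t := by
  induction t with
  | zero => simp [kerPow]
  | succ t ih =>
    simp only [kerPow]
    rw [ENNReal.tsum_comm]
    simp only [ENNReal.tsum_mul_left]
    calc ∑' z, kerPow Q t x z * ∑' y, Q z y ≤ ∑' z, kerPow Q t x z * c :=
          ENNReal.tsum_le_tsum fun z => by gcongr; exact hQ z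
      _ = (∑' z, kerPow Q t x z) * c := ENNReal.tsum_mul_right
      _ ≤ c ^ t * c := by gcongr
      _ = c ^ (t + 1) := (pow_succ c t).symm

/-- The full Green kernel `∑ₜ Qᵗ(x,y)`. -/
noncomputable def greenKernel (Q : V → V → ENNReal) (x y : V) : ENNReal :=
  ∑' t : ℕ, kerPow Q t x y

lemma greenKernel_ne_top {Q : V → V → ENNReal} {c : ENNReal} (hc : c < 1)
    (hQ : ∀ a, ∑' b, Q a b ≤ c) (x y : V) : greenKernel Q x y ≠ ⊤ := by
  have h : greenKernel Q x y ≤ ∑' t : ℕ, c ^ t :=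
    ENNReal.tsum_le_tsum fun t => (ENNReal.le_tsum y).trans (tsum_kerPow_le hQ x t)
  rw [ENNReal.tsum_geometric] at h
  exact (h.trans_lt (ENNReal.inv_lt_top.2 (tsub_pos_of_lt hc))).ne

lemma greenKernel_eq (Q : V → V → ENNReal) (x y : V) :
    greenKernel Q x y = (if x = y then 1 else 0) + ∑' z, greenKernel Q x z * Q z y := by
  rw [greenKernel, tsum_eq_zero_add' ENNReal.summable]
  simp only [kerPow, greenKernel, ← ENNReal.tsum_mul_right]
  rw [ENNReal.tsum_comm]

lemma kerPow_mono {Q Q' : V → V → ENNReal} (h : ∀ a b, Q a b ≤ Q' a b) (t : ℕ) (x y : V) :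
    kerPow Q t x y ≤ kerPow Q' t x y := by
  induction t generalizing y with
  | zero => exact le_rfl
  | succ t ih => exact ENNReal.tsum_le_tsum fun z => mul_le_mul' (ih z) (h z y)

lemma tsum_iSup_of_monotone {α : Type*} {f : ℕ → α → ENNReal} (hf : ∀ a, Monotone fun n => f n a) :
    ∑' a, ⨆ n, f n a = ⨆ n, ∑' a, f n a := by
  simp only [ENNReal.tsum_eq_iSup_sum]
  rw [iSup_comm]
  exact iSup_congr fun s => ENNReal.finsetSum_iSup_of_monotone hf

lemma kerPow_iSup {Q : ℕ → V → V → ENNReal} (hQ : ∀ a b, Monotone fun n => Q n a b) (t : ℕ)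
    (x y : V) : kerPow (fun a b => ⨆ n, Q n a b) t x y = ⨆ n, kerPow (Q n) t x y := by
  have hk : ∀ t y, Monotone fun n => kerPow (Q n) t x y := fun t y n n' h =>
    kerPow_mono (fun a b => hQ a b h) t x y
  induction t generalizing y with
  | zero => simp [kerPow]
  | succ t ih =>
    simp only [kerPow, ih]
    rw [← tsum_iSup_of_monotone fun z n n' h => mul_le_mul' (hk t z h) (hQ z y h)]
    refine tsum_congr fun z => ?_
    simp only [ENNReal.iSup_mul, ENNReal.mul_iSup]
    refine le_antisymm (iSup_le fun i => iSup_le fun j => ?_)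
      (iSup_le fun n => le_iSup_of_le n (le_iSup_of_le n le_rfl))
    exact le_iSup_of_le (max i j)
      (mul_le_mul' (hk t z (le_max_right i j)) (hQ z y (le_max_left i j)))

lemma green_iSup {Q : ℕ → V → V → ENNReal} (hQ : ∀ a b, Monotone fun n => Q n a b) (x : V) :
    green (fun a b => ⨆ n, Q n a b) x = ⨆ n, green (Q n) x := by
  simp only [green, kerPow_iSup hQ]
  exact tsum_iSup_of_monotone fun t n n' h => kerPow_mono (fun a b => hQ a b h) t x x

/-- The kernel `K` killed outside `B` and at rate `1 - r`. -/
noncomputable def killedKernel (B : Finset V) (r : ℝ) (K : V → V → ℝ) (a b : V) : ENNReal :=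
  if a ∈ B ∧ b ∈ B then ENNReal.ofReal (r * K a b) else 0

/-- The density with respect to `m` of the Green kernel of a killed chain is a weak solution of
the Poisson equation. -/
lemma exists_green_density (B : Finset V) {r : ℝ} (hr0 : 0 ≤ r) (hr1 : r < 1) {K : V → V → ℝ}
    (hK : ∀ a b, 0 ≤ K a b) (hsum : ∀ a, ∑ b ∈ B, K a b ≤ 1) {m : V → ℝ} (hm : ∀ a, 0 < m a)
    {x : V} (hx : x ∈ B) :
    ∃ u : V → ℝ, (∀ a, a ∉ B → u a = 0) ∧
      green (killedKernel B r K) x = ENNReal.ofReal (m x * u x) ∧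
      ∀ v : V → ℝ, ∑ a ∈ B, m a * (u a * v a) -
        r * ∑ a ∈ B, ∑ b ∈ B, m a * K a b * (u a * v b) = v x := by
  set Q := killedKernel B r K with hQdef
  have hrow : ∀ a, ∑' b, Q a b ≤ ENNReal.ofReal r := by
    intro a
    rw [tsum_eq_sum (s := B) (fun b hb => by simp [hQdef, killedKernel, hb])]
    calc ∑ b ∈ B, Q a b ≤ ∑ b ∈ B, ENNReal.ofReal (r * K a b) := by
          refine Finset.sum_le_sum fun b _ => ?_
          simp only [hQdef, killedKernel]
          split_ifs <;> simp
      _ = ENNReal.ofReal (r * ∑ b ∈ B, K a b) := by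
          rw [Finset.mul_sum, ENNReal.ofReal_sum_of_nonneg fun b _ => mul_nonneg hr0 (hK a b)]
      _ ≤ ENNReal.ofReal r := ENNReal.ofReal_le_ofReal (mul_le_of_le_one_right hr0 (hsum a))
  have hfin : ∀ y, greenKernel Q x y ≠ ⊤ :=
    greenKernel_ne_top (by simpa using hr1) hrow x
  have heq : ∀ y, greenKernel Q x y =
      (if x = y then 1 else 0) + ∑ z ∈ B, greenKernel Q x z * Q z y := by
    intro y
    rw [greenKernel_eq Q x y,
      tsum_eq_sum (s := B) (fun b hb => by simp [hQdef, killedKernel, hb])]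
  have hreal : ∀ y ∈ B, (greenKernel Q x y).toReal =
      (if x = y then 1 else 0) + ∑ z ∈ B, (greenKernel Q x z).toReal * (r * K z y) := by
    intro y hy
    have hQr : ∀ z ∈ B, greenKernel Q x z * Q z y =
        greenKernel Q x z * ENNReal.ofReal (r * K z y) := by
      intro z hz
      simp [hQdef, killedKernel, hy, hz]
    rw [heq y, Finset.sum_congr rfl hQr, ENNReal.toReal_add (by split_ifs <;> simp)
      (ENNReal.sum_ne_top.2 fun z _ => ENNReal.mul_ne_top (hfin z) ENNReal.ofReal_ne_top),
      ENNReal.toReal_sum fun z _ => ENNReal.mul_ne_top (hfin z) ENNReal.ofReal_ne_top]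
    congr 1
    · split_ifs <;> simp
    · refine Finset.sum_congr rfl fun z _ => ?_
      rw [ENNReal.toReal_mul, ENNReal.toReal_ofReal (mul_nonneg hr0 (hK z y))]
  have hmu : ∀ a, m a * ((greenKernel Q x a).toReal / m a) = (greenKernel Q x a).toReal :=
    fun a => mul_div_cancel₀ _ (hm a).ne'
  refine ⟨fun a => (greenKernel Q x a).toReal / m a, fun a ha => ?_, ?_, fun v => ?_⟩
  · have : greenKernel Q x a = 0 := by
      rw [heq a, if_neg (by rintro rfl; exact ha hx),
        Finset.sum_eq_zero fun z _ => by simp [hQdef, killedKernel, ha], add_zero]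
    simp [this]
  · rw [hmu, ENNReal.ofReal_toReal (hfin x)]
    rfl
  · have h1 : ∑ a ∈ B, m a * ((greenKernel Q x a).toReal / m a * v a) =
        ∑ a ∈ B, ((if x = a then 1 else 0) +
          ∑ z ∈ B, (greenKernel Q x z).toReal * (r * K z a)) * v a := by
      refine Finset.sum_congr rfl fun a ha => ?_
      rw [← mul_assoc, hmu, hreal a ha]
    have h2 : r * ∑ a ∈ B, ∑ b ∈ B, m a * K a b * ((greenKernel Q x a).toReal / m a * v b) =
        ∑ b ∈ B, (∑ a ∈ B, (greenKernel Q x a).toReal * (r * K a b)) * v b := by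
      rw [Finset.sum_comm, Finset.mul_sum]
      refine Finset.sum_congr rfl fun b _ => ?_
      rw [Finset.mul_sum, Finset.sum_mul]
      refine Finset.sum_congr rfl fun a _ => ?_
      linear_combination r * K a b * v b * hmu a
    rw [h1, h2, ← Finset.sum_sub_distrib]
    simp only [← sub_mul, add_sub_cancel_right, ite_mul, one_mul, zero_mul, Finset.sum_ite_eq,
      hx, if_true]

lemma exists_green_eq_iSup_killed [Countable V] (x : V) :
    ∃ (B : ℕ → Finset V) (r : ℕ → ℝ), (∀ n, x ∈ B n) ∧ (∀ n, 0 ≤ r n ∧ r n < 1) ∧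
      ∀ K : V → V → ℝ, (∀ a b, 0 ≤ K a b) →
        green (fun a b => ENNReal.ofReal (K a b)) x = ⨆ n, green (killedKernel (B n) (r n) K) x := by
  obtain ⟨B, hBm, hB⟩ := Filter.exists_seq_monotone_tendsto_atTop_atTop (Finset V)
  have hr : ∀ n : ℕ, 0 ≤ 1 - 1 / ((n : ℝ) + 1) ∧ 1 - 1 / ((n : ℝ) + 1) < 1 := by
    intro n
    have h1 : (0 : ℝ) < 1 / ((n : ℝ) + 1) := Nat.one_div_pos_of_nat
    have h2 : 1 / ((n : ℝ) + 1) ≤ 1 := by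
      rw [div_le_one (by positivity)]; linarith [Nat.cast_nonneg (α := ℝ) n]
    exact ⟨by linarith, by linarith⟩
  refine ⟨fun n => insert x (B n), fun n => 1 - 1 / ((n : ℝ) + 1),
    fun n => Finset.mem_insert_self _ _, hr, fun K hK => ?_⟩
  have hmono : ∀ a b, Monotone fun n : ℕ =>
      killedKernel (insert x (B n)) (1 - 1 / ((n : ℝ) + 1)) K a b := by
    intro a b n n' h
    have hsub : insert x (B n) ⊆ insert x (B n') := Finset.insert_subset_insert _ (hBm h)
    simp only [killedKernel]
    by_cases hab : a ∈ insert x (B n) ∧ b ∈ insert x (B n)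
    · rw [if_pos hab, if_pos ⟨hsub hab.1, hsub hab.2⟩]
      refine ENNReal.ofReal_le_ofReal (mul_le_mul_of_nonneg_right ?_ (hK a b))
      have := Nat.one_div_le_one_div (α := ℝ) h
      linarith
    · rw [if_neg hab]
      exact zero_le
  rw [← green_iSup hmono]
  congr 1
  funext a b
  refine (iSup_eq_of_tendsto (hmono a b) ?_).symm
  have hlim : Filter.Tendsto (fun n : ℕ => ENNReal.ofReal ((1 - 1 / ((n : ℝ) + 1)) * K a b))
      Filter.atTop (nhds (ENNReal.ofReal (K a b))) := by
    refine ENNReal.tendsto_ofReal ?_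
    have := (tendsto_one_div_add_atTop_nhds_zero_nat (𝕜 := ℝ)).const_sub 1 |>.mul_const (K a b)
    simpa using this
  refine hlim.congr' ?_
  filter_upwards [hB.eventually_ge_atTop {a, b}] with n hn
  have ha : a ∈ insert x (B n) := Finset.mem_insert_of_mem (hn (by simp))
  have hb : b ∈ insert x (B n) := Finset.mem_insert_of_mem (hn (by simp))
  rw [killedKernel, if_pos ⟨ha, hb⟩]

end Green

lemma symmetrized_nonneg {V : Type*} {q : V → V → ℝ} {m : V → ℝ} (hq : ∀ x y, 0 ≤ q x y)
    (hm : ∀ x, 0 < m x) (a b : V) : 0 ≤ (q a b + (m b / m a) * q b a) / 2 :=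
  div_nonneg (add_nonneg (hq a b) (mul_nonneg (div_nonneg (hm b).le (hm a).le) (hq b a)))
    zero_le_two

/-- Two-sided comparison of the Green functions of the killed chains. -/
lemma Centered.green_killed_comparison {V : Type*} {q : V → V → ℝ} {m : V → ℝ} {len : ℕ → ℕ}
    {vert : ℕ → ℕ → V} {w : ℕ → ℝ} {C0 : ℕ}
    (hc : Centered q m len vert w C0) (hm : ∀ x, 0 < m x)
    (hq : ∀ x y, 0 ≤ q x y) (hker : ∀ x, ∑' y, q x y = 1) (B : Finset V) {r : ℝ} (hr0 : 0 ≤ r)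
    (hr1 : r < 1) {x : V} (hx : x ∈ B) :
    green (killedKernel B r q) x ≤
        green (killedKernel B r fun a b => (q a b + (m b / m a) * q b a) / 2) x ∧
      green (killedKernel B r fun a b => (q a b + (m b / m a) * q b a) / 2) x ≤
        ENNReal.ofReal (4 * (C0 : ℝ) ^ 2) * green (killedKernel B r q) x := by
  have hrow : ∀ a, ∑ b ∈ B, q a b ≤ 1 := by
    intro a
    exact ((summable_of_tsum_eq_one (hker a)).sum_le_tsum B fun b _ => hq a b).trans_eq (hker a)
  have hrow0 : ∀ a, ∑ b ∈ B, (q a b + (m b / m a) * q b a) / 2 ≤ 1 := by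
    intro a
    have h1 : ∑ b ∈ B, (m b / m a) * q b a ≤ 1 := by
      have h2 := hc.sum_mul_le hm hq hker B a
      have h3 : ∑ b ∈ B, (m b / m a) * q b a = (∑ b ∈ B, m b * q b a) / m a := by
        rw [Finset.sum_div]
        exact Finset.sum_congr rfl fun b _ => by ring
      rw [h3]
      exact (div_le_one (hm a)).2 h2
    rw [← Finset.sum_div, Finset.sum_add_distrib]
    linarith [hrow a]
  obtain ⟨u, hu, hgu, hfu⟩ := exists_green_density B hr0 hr1 hq hrow hm hx
  obtain ⟨v, hv, hgv, hfv⟩ := exists_green_density B hr0 hr1 (symmetrized_nonneg hq hm) hrow0 hm hx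
  let N : (V → ℝ) → (V → ℝ) → ℝ := fun f g => ∑ a ∈ B, m a * (f a * g a)
  let P : (V → ℝ) → (V → ℝ) → ℝ := fun f g => ∑ a ∈ B, ∑ b ∈ B, m a * q a b * (f a * g b)
  have hN_nonneg : ∀ f, 0 ≤ N f f := fun f =>
    Finset.sum_nonneg fun a _ => mul_nonneg (hm a).le (mul_self_nonneg _)
  have hN_comm : ∀ f g, N f g = N g f := fun f g =>
    Finset.sum_congr rfl fun a _ => by ring
  have hw : ∀ i, 0 ≤ w i := fun i => (hc.2.2.2.2.1 i).le
  have hE_nonneg : ∀ f : V → ℝ, (∀ a, a ∉ B → f a = 0) → 0 ≤ N f f - P f f := by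
    intro f hf
    refine (hc.hasSum_form hm hq hker B f f hf hf).nonneg fun i => mul_nonneg (hw i) ?_
    rw [sum_closed_self (len i) (fun j => f (vert i j)) (by simp [hc.2.1 i])]
    exact div_nonneg (Finset.sum_nonneg fun _ _ => sq_nonneg _) zero_le_two
  have hE_sector : N u v - P u v ≤
      2 * (C0 : ℝ) ^ 2 * (N u u - P u u) + 1 / 2 * (N v v - P v v) := by
    refine hasSum_le (fun i => ?_) (hc.hasSum_form hm hq hker B u v hu hv)
      (((hc.hasSum_form hm hq hker B u u hu hu).mul_left _).add
        ((hc.hasSum_form hm hq hker B v v hv hv).mul_left _))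
    have := mul_le_mul_of_nonneg_left (sum_closed_sector (len i) C0 (hc.1 i).2
      (fun j => u (vert i j)) (fun j => v (vert i j)) (by simp [hc.2.1 i]) (by simp [hc.2.1 i]))
      (hw i)
    linarith
  have hC : (1 : ℝ) ≤ (C0 : ℝ) ^ 2 :=
    one_le_pow₀ (by exact_mod_cast (hc.1 0).1.trans (hc.1 0).2)
  have hN_sub : N (u - v) (u - v) = N u u - 2 * N u v + N v v := by
    simp only [N, Finset.mul_sum, ← Finset.sum_add_distrib, ← Finset.sum_sub_distrib]
    exact Finset.sum_congr rfl fun a _ => by simp only [Pi.sub_apply]; ring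
  have hN_sector : N u v ≤ 2 * (C0 : ℝ) ^ 2 * N u u + 1 / 2 * N v v := by
    have h1 : 0 ≤ N (u - v) (u - v) := hN_nonneg _
    nlinarith [hN_nonneg u]
  have hP0 : ∀ f g : V → ℝ, ∑ a ∈ B, ∑ b ∈ B,
      m a * ((q a b + (m b / m a) * q b a) / 2) * (f a * g b) = (P f g + P g f) / 2 := by
    intro f g
    have h : P g f = ∑ a ∈ B, ∑ b ∈ B, m b * q b a * (g b * f a) := Finset.sum_comm
    rw [h]
    simp only [P, ← Finset.sum_add_distrib, Finset.sum_div]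
    refine Finset.sum_congr rfl fun a _ => Finset.sum_congr rfl fun b _ => ?_
    have := (hm a).ne'
    field_simp
  have huu : N u u - r * P u u = u x := hfu u
  have huv : N u v - r * P u v = v x := hfu v
  have hvv : N v v - r * P v v = v x := by
    have := hfv v
    rw [hP0] at this
    change N v v - _ = _ at this
    linarith
  have hvu : N u v - r * ((P u v + P v u) / 2) = u x := by
    have := hfv u
    rw [hP0] at this
    change N v u - _ = _ at this
    rw [hN_comm u v]
    linarith
  have hle1 : u x ≤ v x := by
    have h0 := hE_nonneg (u - v) fun a ha => by simp [hu a ha, hv a ha]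
    have h1 := hN_nonneg (u - v)
    have h3 : P (u - v) (u - v) = P u u - (P u v + P v u) + P v v := by
      simp only [P, ← Finset.sum_add_distrib, ← Finset.sum_sub_distrib]
      exact Finset.sum_congr rfl fun a _ => Finset.sum_congr rfl fun b _ => by
        simp only [Pi.sub_apply]; ring
    have h4 := mul_nonneg hr0 h0
    have h5 := mul_nonneg (sub_nonneg.2 hr1.le) h1
    rw [h3] at h4
    rw [hN_sub] at h4 h5
    linarith
  have hle2 : v x ≤ 4 * (C0 : ℝ) ^ 2 * u x := by
    have h4 := mul_le_mul_of_nonneg_left hE_sector hr0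
    have h5 := mul_le_mul_of_nonneg_left hN_sector (sub_nonneg.2 hr1.le)
    have h6 : v x ≤ 2 * (C0 : ℝ) ^ 2 * u x + 1 / 2 * v x := by
      calc v x = (1 - r) * N u v + r * (N u v - P u v) := by rw [← huv]; ring
        _ ≤ _ := add_le_add h5 h4
        _ = 2 * (C0 : ℝ) ^ 2 * (N u u - r * P u u) + 1 / 2 * (N v v - r * P v v) := by ring
        _ = _ := by rw [huu, hvv]
    linarith
  rw [hgu, hgv, ← ENNReal.ofReal_mul (by positivity)]
  refine ⟨ENNReal.ofReal_le_ofReal (mul_le_mul_of_nonneg_left hle1 (hm x).le),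
    ENNReal.ofReal_le_ofReal ?_⟩
  have := mul_le_mul_of_nonneg_left hle2 (hm x).le
  linarith

/-- if `Γ = (V,q)` is centered for `m` and the chain is irreducible, then
the chain with kernel `q` is recurrent iff the additively symmetrized chain with kernel
`q⁰(x,y) = (q(x,y) + (m y / m x) q(y,x))/2` is recurrent. -/
theorem centered_recurrence_iff_symmetrized_recurrence {V : Type*} [Countable V]
    (q : V → V → ℝ) (m : V → ℝ)
    (len : ℕ → ℕ) (vert : ℕ → ℕ → V) (w : ℕ → ℝ) (C0 : ℕ)
    (hq : ∀ x y, 0 ≤ q x y) (hker : ∀ x, ∑' y, q x y = 1)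
    (hm : ∀ x, 0 < m x)
    (hc : Centered q m len vert w C0)
    (hirr : ∀ x y : V, ∃ t : ℕ, kerPow (fun a b => ENNReal.ofReal (q a b)) t x y ≠ 0) :
    ∀ x : V,
      (green (fun a b => ENNReal.ofReal (q a b)) x = ⊤ ↔
        green (fun a b => ENNReal.ofReal ((q a b + (m b / m a) * q b a) / 2)) x = ⊤) := by
  intro x
  obtain ⟨B, r, hx, hr, hgreen⟩ := exists_green_eq_iSup_killed x
  have hcmp := fun n => hc.green_killed_comparison hm hq hker (B n) (hr n).1 (hr n).2 (hx n)
  rw [hgreen q hq, hgreen _ (symmetrized_nonneg hq hm)]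
  refine ⟨fun h => top_le_iff.1 (h ▸ iSup_mono fun n => (hcmp n).1), fun h => ?_⟩
  have h1 : (⊤ : ENNReal) ≤
      ENNReal.ofReal (4 * (C0 : ℝ) ^ 2) * ⨆ n, green (killedKernel (B n) (r n) q) x := by
    rw [← h, ENNReal.mul_iSup]
    exact iSup_mono fun n => (hcmp n).2
  by_contra hne
  exact ENNReal.mul_ne_top ENNReal.ofReal_ne_top hne (top_le_iff.1 h1)
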